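/- Let c ∈ ℭ_+. If P, Q ∈ 𝔓̄_+ \ {0} are such that the measure dμ = (P/Q) dm satisfies the moment conditions c_k = ∫_{𝕋^d} e^{i(k,θ)} (P/Q) dm for all k ∈ Λ, then Q is the unique minimizer of the dual functional J_P over 𝔓̄_+ \ {0}. -/

import Mathlib

open MeasureTheory Complex Set

noncomputable section

namespace RCE

/-- The scalar product (k,θ) = Σⱼ kⱼ θⱼ. -/
def dotP (d : ℕ) (k : Fin d → ℤ) (θ : Fin d → ℝ) : ℝ := ∑ j, (k j : ℝ) * θ j

/-- The d-dimensional torus 𝕋^d = (−π,π]^d. -/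
def Td (d : ℕ) : Set (Fin d → ℝ) := Set.univ.pi fun _ => Set.Ioc (-Real.pi) Real.pi

/-- Normalized Lebesgue measure dm = (2π)^{-d} dθ on 𝕋^d. -/
def dm (d : ℕ) : Measure (Fin d → ℝ) :=
  (ENNReal.ofReal ((2 * Real.pi) ^ d))⁻¹ • (volume.restrict (Td d))

/-- Conjugate-symmetric coefficient sequences supported on Λ. -/
def IsCoeff (d : ℕ) (Λ : Finset (Fin d → ℤ)) (p : (Fin d → ℤ) → ℂ) : Prop :=
  (∀ k, k ∉ Λ → p k = 0) ∧ ∀ k, p (-k) = starRingEnd ℂ (p k)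

/-- Evaluation of the (real-valued) trigonometric polynomial
`P(e^{iθ}) = Σ_{k∈Λ} p_k e^{-i(k,θ)}`. -/
def eval (d : ℕ) (Λ : Finset (Fin d → ℤ)) (p : (Fin d → ℤ) → ℂ) (θ : Fin d → ℝ) : ℝ :=
  (∑ k ∈ Λ, p k * Complex.exp (-(dotP d k θ : ℂ) * Complex.I)).re

/-- `𝔓̄₊` : the closed cone of nonnegative trigonometric polynomials. -/
def Pbar (d : ℕ) (Λ : Finset (Fin d → ℤ)) : Set ((Fin d → ℤ) → ℂ) :=
  {p | IsCoeff d Λ p ∧ ∀ θ ∈ Td d, 0 ≤ eval d Λ p θ}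

/-- `𝔓₊` : the open cone of positive trigonometric polynomials. -/
def Pplus (d : ℕ) (Λ : Finset (Fin d → ℤ)) : Set ((Fin d → ℤ) → ℂ) :=
  {p | IsCoeff d Λ p ∧ ∀ θ ∈ Td d, 0 < eval d Λ p θ}

/-- The pairing ⟨c,p⟩ = Σ_{k∈Λ} c_k conj(p_k) (real-valued by conjugate symmetry). -/
def pair (d : ℕ) (Λ : Finset (Fin d → ℤ)) (c p : (Fin d → ℤ) → ℂ) : ℝ :=
  (∑ k ∈ Λ, c k * starRingEnd ℂ (p k)).re

/-- `ℭ₊` : the interior of the dual cone. -/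
def Cplus (d : ℕ) (Λ : Finset (Fin d → ℤ)) : Set ((Fin d → ℤ) → ℂ) :=
  {c | IsCoeff d Λ c ∧ ∀ p ∈ Pbar d Λ, p ≠ 0 → 0 < pair d Λ c p}

/-- `ℭ̄₊` : the closed dual cone. -/
def Cbar (d : ℕ) (Λ : Finset (Fin d → ℤ)) : Set ((Fin d → ℤ) → ℂ) :=
  {c | IsCoeff d Λ c ∧ ∀ p ∈ Pbar d Λ, 0 ≤ pair d Λ c p}

/-- The dual functional J_P(Q) = ⟨c,q⟩ − ∫ P log Q dm. -/
def J (d : ℕ) (Λ : Finset (Fin d → ℤ)) (c P Q : (Fin d → ℤ) → ℂ) : ℝ :=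
  pair d Λ c Q - ∫ θ, eval d Λ P θ * Real.log (eval d Λ Q θ) ∂(dm d)

/-- Covariance matching for an absolutely continuous measure Φ dm:
`c_k = ∫ e^{i(k,θ)} Φ(θ) dm(θ)` for all k ∈ Λ. -/
def Matches (d : ℕ) (Λ : Finset (Fin d → ℤ)) (c : (Fin d → ℤ) → ℂ)
    (Φ : (Fin d → ℝ) → ℝ) : Prop :=
  ∀ k ∈ Λ, c k = ∫ θ, Complex.exp ((dotP d k θ : ℂ) * Complex.I) * (Φ θ : ℂ) ∂(dm d)

/-- Finitely many lattice points are separated by some integral linear functional. -/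
theorem exists_injOn_sum_mul {d : ℕ} (Λ : Finset (Fin d → ℤ)) :
    ∃ v : Fin d → ℤ, Set.InjOn (fun k : Fin d → ℤ => ∑ j, k j * v j) Λ := by
  classical
  let f : (Fin d → ℤ) → Polynomial ℤ := fun m => ∑ j : Fin d, Polynomial.monomial (j : ℕ) (m j)
  have hf : ∀ m, m ≠ 0 → f m ≠ 0 := by
    intro m hm h
    obtain ⟨j, hj⟩ := Function.ne_iff.1 hm
    apply hj
    have := congrArg (fun q => q.coeff (j : ℕ)) h
    simpa [f, Polynomial.finsetSum_coeff, Polynomial.coeff_monomial, Fin.val_inj] using this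
  let S : Finset (Fin d → ℤ) := ((Λ ×ˢ Λ).image fun x => x.1 - x.2).erase 0
  have hS : ∏ m ∈ S, f m ≠ 0 :=
    Finset.prod_ne_zero_iff.2 fun m hm => hf m (Finset.ne_of_mem_erase hm)
  obtain ⟨N, hN⟩ : ∃ N : ℤ, (∏ m ∈ S, f m).eval N ≠ 0 := by
    by_contra! h
    exact hS (Polynomial.funext fun N => by simpa using h N)
  refine ⟨fun j => N ^ (j : ℕ), fun k hk l hl hkl => ?_⟩
  by_contra hne
  rw [Polynomial.eval_prod, Finset.prod_ne_zero_iff] at hN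
  refine hN (k - l) (Finset.mem_erase.2 ⟨sub_ne_zero.2 hne,
    Finset.mem_image.2 ⟨(k, l), Finset.mem_product.2 ⟨hk, hl⟩, rfl⟩⟩) ?_
  simpa [f, Polynomial.eval_finsetSum, sub_mul, sub_eq_zero] using hkl

/-- The logarithmic deficit `log (B + 1) - log x`, with value `∞` at `x = 0`. -/
def logDeficit (B x : ℝ) : ENNReal :=
  open Classical in if x = 0 then ⊤ else ENNReal.ofReal (Real.log (B + 1) - Real.log x)

theorem measurable_logDeficit (B : ℝ) : Measurable (logDeficit B) :=
  Measurable.ite (measurableSet_singleton 0) measurable_const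
    (measurable_const.sub Real.measurable_log).ennreal_ofReal

theorem log_le_log_add_one {B x : ℝ} (hx : 0 ≤ x) (hxB : x ≤ B) :
    Real.log x ≤ Real.log (B + 1) := by
  rcases hx.eq_or_lt with rfl | h
  · simpa using Real.log_nonneg (by linarith)
  · exact Real.log_le_log h (by linarith)

theorem lintegral_logDeficit_polynomial_le {q : Polynomial ℂ} (hq : q ≠ 0) {B ε : ℝ}
    (hB : ∀ t, ‖q.eval (circleMap 0 1 t)‖ ≤ B) (hε : 0 < ε) (hεq : ε ≤ ‖q.leadingCoeff‖) :
    ∫⁻ t in Ioc 0 (2 * Real.pi), logDeficit B ‖q.eval (circleMap 0 1 t)‖ ≤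
      ENNReal.ofReal (2 * Real.pi * (Real.log (B + 1) - Real.log ε)) := by
  have hpi : (0 : ℝ) ≤ 2 * Real.pi := by positivity
  have hint := q.intervalIntegrable_mahlerMeasure
  have hint' : IntegrableOn (fun t => Real.log (B + 1) - Real.log ‖q.eval (circleMap 0 1 t)‖)
      (Ioc 0 (2 * Real.pi)) :=
    ((intervalIntegrable_iff_integrableOn_Ioc_of_le hpi).1
      (intervalIntegrable_const.sub hint))
  have hae : ∀ᵐ t ∂(volume.restrict (Ioc 0 (2 * Real.pi))), q.eval (circleMap 0 1 t) ≠ 0 := by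
    have hfin : ((circleMap 0 1) ⁻¹' {z | q.IsRoot z}).Countable :=
      (Polynomial.finite_setOfPred_isRoot hq).countable.preimage_circleMap 0 one_ne_zero
    exact ae_restrict_of_ae (hfin.ae_notMem volume)
  calc ∫⁻ t in Ioc 0 (2 * Real.pi), logDeficit B ‖q.eval (circleMap 0 1 t)‖
      = ∫⁻ t in Ioc 0 (2 * Real.pi),
          ENNReal.ofReal (Real.log (B + 1) - Real.log ‖q.eval (circleMap 0 1 t)‖) := by
        refine lintegral_congr_ae ?_
        filter_upwards [hae] with t ht
        simp [logDeficit, ht]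
    _ = ENNReal.ofReal (∫ t in Ioc 0 (2 * Real.pi),
          (Real.log (B + 1) - Real.log ‖q.eval (circleMap 0 1 t)‖)) :=
        (ofReal_integral_eq_lintegral_ofReal hint' (Filter.Eventually.of_forall fun t =>
          sub_nonneg.2 (log_le_log_add_one (norm_nonneg _) (hB t)))).symm
    _ ≤ _ := by
        refine ENNReal.ofReal_le_ofReal ?_
        rw [← intervalIntegral.integral_of_le hpi,
          intervalIntegral.integral_sub intervalIntegrable_const hint,
          intervalIntegral.integral_const]
        have h1 : Real.log ε ≤ q.logMahlerMeasure := by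
          rw [Polynomial.logMahlerMeasure_eq_log_MahlerMeasure]
          exact Real.log_le_log hε (hεq.trans q.leadingCoeff_le_mahlerMeasure)
        rw [Polynomial.logMahlerMeasure_def, Real.circleAverage_def, smul_eq_mul,
          inv_mul_eq_div, le_div_iff₀ (by positivity)] at h1
        simp only [smul_eq_mul, sub_zero]
        linarith

/-- The trigonometric sum whose real part is `eval`. -/
def trigSum {d : ℕ} (Λ : Finset (Fin d → ℤ)) (p : (Fin d → ℤ) → ℂ) (θ : Fin d → ℝ) : ℂ :=
  ∑ k ∈ Λ, p k * Complex.exp (-(dotP d k θ : ℂ) * Complex.I)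

theorem norm_exp_neg_mul_I (x : ℝ) : ‖Complex.exp (-(x : ℂ) * Complex.I)‖ = 1 := by
  simpa using Complex.norm_exp_ofReal_mul_I (-x)

theorem norm_trigSum_le {d : ℕ} (Λ : Finset (Fin d → ℤ)) (p : (Fin d → ℤ) → ℂ)
    (θ : Fin d → ℝ) : ‖trigSum Λ p θ‖ ≤ ∑ k ∈ Λ, ‖p k‖ :=
  (norm_sum_le _ _).trans_eq <| Finset.sum_congr rfl fun k _ => by
    rw [norm_mul, norm_exp_neg_mul_I, mul_one]

@[fun_prop]
theorem continuous_trigSum {d : ℕ} (Λ : Finset (Fin d → ℤ)) (p : (Fin d → ℤ) → ℂ) :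
    Continuous (trigSum Λ p) := by
  unfold trigSum dotP
  fun_prop

/-- Along an integral direction separating the frequencies, a trigonometric polynomial becomes,
up to a unimodular factor, an algebraic polynomial on the unit circle whose leading coefficient
has the modulus of one of the original coefficients. -/
theorem exists_polynomial_norm_trigSum_eq {d : ℕ} {Λ : Finset (Fin d → ℤ)}
    {p : (Fin d → ℤ) → ℂ} {v : Fin d → ℤ}
    (hv : Set.InjOn (fun k : Fin d → ℤ => ∑ j, k j * v j) Λ) (hp : ∃ k ∈ Λ, p k ≠ 0)
    (θ : Fin d → ℝ) :
    ∃ q : Polynomial ℂ, q ≠ 0 ∧ (∃ k ∈ Λ, p k ≠ 0 ∧ ‖q.leadingCoeff‖ = ‖p k‖) ∧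
      ∀ t : ℝ, ‖q.eval (circleMap 0 1 t)‖ = ‖trigSum Λ p (fun j => θ j + t * v j)‖ := by
  classical
  obtain ⟨M, hM⟩ : ∃ M : ℤ, ∀ k ∈ Λ, ∑ j, k j * v j ≤ M := by
    obtain ⟨M, hM⟩ := (Λ.image fun k => ∑ j, k j * v j).bddAbove
    exact ⟨M, fun k hk => hM (Finset.mem_coe.2 (Finset.mem_image_of_mem _ hk))⟩
  let e : (Fin d → ℤ) → ℕ := fun k => (M - ∑ j, k j * v j).toNat
  have he : ∀ k ∈ Λ, ((e k : ℕ) : ℤ) = M - ∑ j, k j * v j := fun k hk =>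
    Int.toNat_of_nonneg (sub_nonneg.2 (hM k hk))
  have hinj : Set.InjOn e Λ := fun k hk l hl hkl => hv hk hl <| by
    have h1 := he k hk
    have h2 := he l hl
    rw [hkl] at h1
    simp only
    linarith
  let a : (Fin d → ℤ) → ℂ := fun k => p k * Complex.exp (-(dotP d k θ : ℂ) * Complex.I)
  have ha : ∀ k, ‖a k‖ = ‖p k‖ := fun k => by rw [norm_mul, norm_exp_neg_mul_I, mul_one]
  let q : Polynomial ℂ := ∑ k ∈ Λ, Polynomial.monomial (e k) (a k)
  have hcoeff : ∀ k ∈ Λ, q.coeff (e k) = a k := by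
    intro k hk
    simp only [q, Polynomial.finsetSum_coeff, Polynomial.coeff_monomial]
    rw [Finset.sum_eq_single_of_mem k hk fun l hl hlk => if_neg fun h => hlk (hinj hl hk h),
      if_pos rfl]
  have hq : q ≠ 0 := by
    obtain ⟨k, hk, hpk⟩ := hp
    intro h
    have := ha k
    rw [← hcoeff k hk, h, Polynomial.coeff_zero, norm_zero] at this
    exact hpk (norm_eq_zero.1 this.symm)
  refine ⟨q, hq, ?_, fun t => ?_⟩
  · have hlc : q.coeff q.natDegree ≠ 0 := Polynomial.leadingCoeff_ne_zero.2 hq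
    obtain ⟨k, hk, hke⟩ : ∃ k ∈ Λ, e k = q.natDegree := by
      by_contra! h
      refine hlc ?_
      conv_lhs => simp only [q, Polynomial.finsetSum_coeff, Polynomial.coeff_monomial]
      exact Finset.sum_eq_zero fun k hk => if_neg (h k hk)
    have hlk : q.leadingCoeff = a k := by rw [← hcoeff k hk, hke]; rfl
    refine ⟨k, hk, fun h => hlc ?_, by rw [hlk, ha]⟩
    rw [← hke, hcoeff k hk]
    simp [a, h]
  · have : q.eval (circleMap 0 1 t) = Complex.exp ((M * t : ℝ) * Complex.I) *
        trigSum Λ p (fun j => θ j + t * v j) := by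
      simp only [q, Polynomial.eval_finsetSum, Polynomial.eval_monomial, trigSum, Finset.mul_sum]
      refine Finset.sum_congr rfl fun k hk => ?_
      have h1 : circleMap 0 1 t ^ e k =
          Complex.exp ((M - ∑ j, k j * v j : ℤ) * (t * Complex.I)) := by
        rw [← he k hk, circleMap_zero, Int.cast_natCast, Complex.exp_nat_mul]
        simp
      have h2 : dotP d k (fun j => θ j + t * v j) = dotP d k θ + t * ∑ j, (k j * v j : ℝ) := by
        simp only [dotP, mul_add, Finset.sum_add_distrib, Finset.mul_sum]
        congr 1
        exact Finset.sum_congr rfl fun j _ => by ring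
      rw [h1, h2, mul_assoc, mul_left_comm (Complex.exp ((M * t : ℝ) * Complex.I)),
        ← Complex.exp_add, ← Complex.exp_add]
      congr 2
      push_cast
      ring
    rw [this, norm_mul, Complex.norm_exp_ofReal_mul_I, one_mul]

theorem lintegral_logDeficit_trigSum_ne_top {d : ℕ} {Λ : Finset (Fin d → ℤ)}
    {p : (Fin d → ℤ) → ℂ} (hp : ∃ k ∈ Λ, p k ≠ 0) :
    ∫⁻ θ in Td d, logDeficit (∑ k ∈ Λ, ‖p k‖) ‖trigSum Λ p θ‖ ≠ ⊤ := by
  classical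
  obtain ⟨v, hv⟩ := exists_injOn_sum_mul Λ
  set B := ∑ k ∈ Λ, ‖p k‖
  obtain ⟨ε, hε, hεp⟩ : ∃ ε : ℝ, 0 < ε ∧ ∀ k ∈ Λ, p k ≠ 0 → ε ≤ ‖p k‖ := by
    obtain ⟨k₀, hk₀, hpk₀⟩ := hp
    obtain ⟨k, hk, hmin⟩ := (Λ.filter fun k => p k ≠ 0).exists_min_image (fun k => ‖p k‖)
      ⟨k₀, Finset.mem_filter.2 ⟨hk₀, hpk₀⟩⟩
    exact ⟨‖p k‖, norm_pos_iff.2 (Finset.mem_filter.1 hk).2,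
      fun l hl hpl => hmin l (Finset.mem_filter.2 ⟨hl, hpl⟩)⟩
  let g : (Fin d → ℝ) → ENNReal := fun θ => logDeficit B ‖trigSum Λ p θ‖
  have hg : Measurable g :=
    (measurable_logDeficit B).comp (continuous_trigSum Λ p).norm.measurable
  let w : Fin d → ℝ := fun j => v j
  let T : Set ℝ := Ioc 0 (2 * Real.pi)
  have hline : ∀ θ : Fin d → ℝ, ∫⁻ t in T, g (θ + t • w) ≤
      ENNReal.ofReal (2 * Real.pi * (Real.log (B + 1) - Real.log ε)) := by
    intro θ
    obtain ⟨q, hq, ⟨k, hk, hpk, hlc⟩, hnorm⟩ := exists_polynomial_norm_trigSum_eq hv hp θ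
    have := lintegral_logDeficit_polynomial_le hq (B := B)
      (fun t => (hnorm t).trans_le (norm_trigSum_le _ _ _)) hε ((hεp k hk hpk).trans_eq hlc.symm)
    simp only [hnorm] at this
    exact this
  obtain ⟨R, hR⟩ : ∃ R : ℝ, ∀ θ ∈ Td d, ∀ t ∈ T, θ - t • w ∈ Metric.closedBall 0 R := by
    refine ⟨Real.pi + 2 * Real.pi * ‖w‖, fun θ hθ t ht => mem_closedBall_zero_iff.2 ?_⟩
    have h1 : ‖θ‖ ≤ Real.pi := (pi_norm_le_iff_of_nonneg Real.pi_pos.le).2 fun j =>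
      abs_le.2 ⟨(hθ j trivial).1.le, (hθ j trivial).2⟩
    have h2 : ‖t • w‖ ≤ 2 * Real.pi * ‖w‖ := by
      rw [norm_smul, Real.norm_of_nonneg ht.1.le]
      gcongr
      exact ht.2
    exact (norm_sub_le _ _).trans (add_le_add h1 h2)
  set D : Set (Fin d → ℝ) := Metric.closedBall 0 R
  have htrans : ∀ t ∈ T, ∫⁻ θ in Td d, g θ ≤ ∫⁻ θ in D, g (θ + t • w) := by
    intro t ht
    have hTd : MeasurableSet (Td d) := MeasurableSet.univ_pi fun _ => measurableSet_Ioc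
    have hD : MeasurableSet D := Metric.isClosed_closedBall.measurableSet
    rw [← lintegral_indicator hTd, ← lintegral_indicator hD,
      ← lintegral_add_right_eq_self _ (t • w)]
    refine lintegral_mono fun θ => ?_
    by_cases h : θ + t • w ∈ Td d
    · have hθ : θ ∈ D := by simpa using hR _ h t ht
      simp [h, hθ]
    · simp [h]
  have hbound : volume T * ∫⁻ θ in Td d, g θ ≤
      volume D * ENNReal.ofReal (2 * Real.pi * (Real.log (B + 1) - Real.log ε)) := by
    calc volume T * ∫⁻ θ in Td d, g θ = ∫⁻ _ in T, ∫⁻ θ in Td d, g θ := by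
          rw [setLIntegral_const, mul_comm]
      _ ≤ ∫⁻ t in T, ∫⁻ θ in D, g (θ + t • w) := setLIntegral_mono' measurableSet_Ioc htrans
      _ = ∫⁻ θ in D, ∫⁻ t in T, g (θ + t • w) :=
          lintegral_lintegral_swap (hg.comp (by fun_prop)).aemeasurable
      _ ≤ ∫⁻ _ in D, ENNReal.ofReal (2 * Real.pi * (Real.log (B + 1) - Real.log ε)) :=
          lintegral_mono hline
      _ = _ := by rw [setLIntegral_const, mul_comm]
  intro htop
  have hT : volume T ≠ 0 := by simp [T, Real.pi_pos]
  have : volume T * ∫⁻ θ in Td d, g θ = ⊤ := by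
    rw [show ∫⁻ θ in Td d, g θ = ⊤ from htop, ENNReal.mul_top hT]
  rw [this, top_le_iff] at hbound
  exact ENNReal.mul_ne_top (isCompact_closedBall 0 R).measure_ne_top ENNReal.ofReal_ne_top hbound

theorem ae_trigSum_ne_zero {d : ℕ} {Λ : Finset (Fin d → ℤ)} {p : (Fin d → ℤ) → ℂ}
    (hp : ∃ k ∈ Λ, p k ≠ 0) : ∀ᵐ θ ∂(volume.restrict (Td d)), trigSum Λ p θ ≠ 0 := by
  have hmeas : Measurable fun θ => logDeficit (∑ k ∈ Λ, ‖p k‖) ‖trigSum Λ p θ‖ :=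
    (measurable_logDeficit _).comp (continuous_trigSum Λ p).norm.measurable
  filter_upwards [ae_lt_top hmeas (lintegral_logDeficit_trigSum_ne_top hp)] with θ hθ h
  simp [logDeficit, h] at hθ

theorem isFiniteMeasure_restrict_Td (d : ℕ) : IsFiniteMeasure (volume.restrict (Td d)) := by
  refine ⟨?_⟩
  simp [Td, Real.volume_pi_Ioc, ENNReal.ofReal_lt_top]

theorem integrableOn_log_norm_trigSum {d : ℕ} {Λ : Finset (Fin d → ℤ)} {p : (Fin d → ℤ) → ℂ}
    (hp : ∃ k ∈ Λ, p k ≠ 0) : IntegrableOn (fun θ => Real.log ‖trigSum Λ p θ‖) (Td d) := by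
  have := isFiniteMeasure_restrict_Td d
  set B := ∑ k ∈ Λ, ‖p k‖
  have hmeas : Measurable fun θ => Real.log ‖trigSum Λ p θ‖ :=
    Real.measurable_log.comp (continuous_trigSum Λ p).norm.measurable
  have key : Integrable (fun θ => Real.log (B + 1) - Real.log ‖trigSum Λ p θ‖)
      (volume.restrict (Td d)) := by
    refine (lintegral_ofReal_ne_top_iff_integrable
      (measurable_const.sub hmeas).aestronglyMeasurable (Filter.Eventually.of_forall fun θ =>
        sub_nonneg.2 (log_le_log_add_one (norm_nonneg _) (norm_trigSum_le _ _ _)))).1 ?_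
    refine ne_top_of_le_ne_top (lintegral_logDeficit_trigSum_ne_top hp)
      (lintegral_mono fun θ => ?_)
    unfold logDeficit
    split_ifs <;> simp
  exact ((integrable_const (Real.log (B + 1))).sub key).congr
    (Filter.Eventually.of_forall fun θ => by simp)

theorem IsCoeff.exists_ne_zero {d : ℕ} {Λ : Finset (Fin d → ℤ)} {p : (Fin d → ℤ) → ℂ}
    (hp : IsCoeff d Λ p) (hp0 : p ≠ 0) : ∃ k ∈ Λ, p k ≠ 0 := by
  obtain ⟨k, hk⟩ := Function.ne_iff.1 hp0
  exact ⟨k, by_contra fun h => hk (hp.1 k h), hk⟩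

theorem IsCoeff.ofReal_eval {d : ℕ} {Λ : Finset (Fin d → ℤ)} {p : (Fin d → ℤ) → ℂ}
    (hp : IsCoeff d Λ p) (hΛ : ∀ k ∈ Λ, -k ∈ Λ) (θ : Fin d → ℝ) :
    (eval d Λ p θ : ℂ) = trigSum Λ p θ := by
  refine Complex.conj_eq_iff_re.1 ?_
  rw [map_sum]
  refine Finset.sum_bij' (fun k _ => -k) (fun k _ => -k) hΛ hΛ (by simp) (by simp) fun k _ => ?_
  rw [map_mul, ← hp.2, ← Complex.exp_conj]
  simp [dotP]

theorem IsCoeff.norm_trigSum {d : ℕ} {Λ : Finset (Fin d → ℤ)} {p : (Fin d → ℤ) → ℂ}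
    (hp : IsCoeff d Λ p) (hΛ : ∀ k ∈ Λ, -k ∈ Λ) (θ : Fin d → ℝ) :
    ‖trigSum Λ p θ‖ = |eval d Λ p θ| := by
  rw [← hp.ofReal_eval hΛ, Complex.norm_real, Real.norm_eq_abs]

theorem IsCoeff.sub {d : ℕ} {Λ : Finset (Fin d → ℤ)} {p q : (Fin d → ℤ) → ℂ}
    (hp : IsCoeff d Λ p) (hq : IsCoeff d Λ q) : IsCoeff d Λ (p - q) :=
  ⟨fun k hk => by simp [hp.1 k hk, hq.1 k hk], fun k => by simp [hp.2, hq.2]⟩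

theorem eval_sub {d : ℕ} (Λ : Finset (Fin d → ℤ)) (p q : (Fin d → ℤ) → ℂ) (θ : Fin d → ℝ) :
    eval d Λ (p - q) θ = eval d Λ p θ - eval d Λ q θ := by
  simp [eval, sub_mul]

theorem continuous_eval {d : ℕ} (Λ : Finset (Fin d → ℤ)) (p : (Fin d → ℤ) → ℂ) :
    Continuous (eval d Λ p) :=
  Complex.continuous_re.comp (continuous_trigSum Λ p)

theorem abs_eval_le {d : ℕ} (Λ : Finset (Fin d → ℤ)) (p : (Fin d → ℤ) → ℂ) (θ : Fin d → ℝ) :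
    |eval d Λ p θ| ≤ ∑ k ∈ Λ, ‖p k‖ :=
  (Complex.abs_re_le_norm _).trans (norm_trigSum_le Λ p θ)

theorem dm_eq_smul (d : ℕ) :
    ∃ a : ENNReal, a ≠ 0 ∧ a ≠ ⊤ ∧ dm d = a • volume.restrict (Td d) :=
  ⟨_, ENNReal.inv_ne_zero.2 ENNReal.ofReal_ne_top,
    ENNReal.inv_ne_top.2 (ENNReal.ofReal_pos.2 (by positivity)).ne', rfl⟩

theorem ae_dm_of_ae_restrict {d : ℕ} {s : (Fin d → ℝ) → Prop}
    (h : ∀ᵐ θ ∂(volume.restrict (Td d)), s θ) : ∀ᵐ θ ∂(dm d), s θ :=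
  Measure.ae_smul_measure h _

theorem dm_ne_zero (d : ℕ) : dm d ≠ 0 := by
  obtain ⟨a, ha, -, h⟩ := dm_eq_smul d
  rw [h, Ne, Measure.ennreal_smul_eq_zero, not_or, Measure.restrict_eq_zero, Td,
    Real.volume_pi_Ioc, Finset.prod_eq_zero_iff]
  simp [ha, Real.pi_pos]

theorem IsCoeff.ae_eval_ne_zero {d : ℕ} {Λ : Finset (Fin d → ℤ)} {p : (Fin d → ℤ) → ℂ}
    (hp : IsCoeff d Λ p) (hΛ : ∀ k ∈ Λ, -k ∈ Λ) (hp0 : p ≠ 0) :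
    ∀ᵐ θ ∂(dm d), eval d Λ p θ ≠ 0 := by
  filter_upwards [ae_dm_of_ae_restrict (ae_trigSum_ne_zero (hp.exists_ne_zero hp0))] with θ hθ h
  exact hθ (by rw [← hp.ofReal_eval hΛ, h, Complex.ofReal_zero])

theorem IsCoeff.integrable_log_eval {d : ℕ} {Λ : Finset (Fin d → ℤ)} {p : (Fin d → ℤ) → ℂ}
    (hp : IsCoeff d Λ p) (hΛ : ∀ k ∈ Λ, -k ∈ Λ) (hp0 : p ≠ 0) :
    Integrable (fun θ => Real.log (eval d Λ p θ)) (dm d) := by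
  obtain ⟨a, -, ha, h⟩ := dm_eq_smul d
  rw [h]
  refine Integrable.smul_measure ?_ ha
  simpa only [hp.norm_trigSum hΛ, Real.log_abs] using!
    integrableOn_log_norm_trigSum (hp.exists_ne_zero hp0)

theorem integrable_eval_mul {d : ℕ} {μ : Measure (Fin d → ℝ)}
    {f : (Fin d → ℝ) → ℝ} (hf : Integrable f μ)
    (Λ : Finset (Fin d → ℤ)) (p : (Fin d → ℤ) → ℂ) :
    Integrable (fun θ => eval d Λ p θ * f θ) μ :=
  hf.bdd_mul (continuous_eval Λ p).aestronglyMeasurable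
    (Filter.Eventually.of_forall fun θ => abs_eval_le Λ p θ)

theorem Matches.integrable {d : ℕ} {Λ : Finset (Fin d → ℤ)} {c : (Fin d → ℤ) → ℂ}
    {Φ : (Fin d → ℝ) → ℝ} (h : Matches d Λ c Φ) (h0 : (0 : Fin d → ℤ) ∈ Λ)
    (hc : c ∈ Cplus d Λ) : Integrable Φ (dm d) := by
  classical
  have hone : Pi.single 0 1 ∈ Pbar d Λ := by
    refine ⟨⟨fun k hk => Pi.single_eq_of_ne (ne_of_mem_of_not_mem h0 hk).symm 1, fun k => ?_⟩,
      fun θ _ => ?_⟩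
    · by_cases hk : k = 0 <;> simp [hk]
    · simp [eval, Pi.single_apply, h0, dotP]
  have hpos := hc.2 _ hone (by simp)
  have hc0 : c 0 = ((∫ θ, Φ θ ∂(dm d) : ℝ) : ℂ) := by
    rw [h 0 h0, ← integral_complex_ofReal]
    simp [dotP]
  by_contra hΦ
  rw [integral_undef hΦ, Complex.ofReal_zero] at hc0
  simp [pair, Pi.single_apply, h0, hc0, apply_ite] at hpos

theorem Matches.pair_eq_integral {d : ℕ} {Λ : Finset (Fin d → ℤ)} {c : (Fin d → ℤ) → ℂ}
    {Φ : (Fin d → ℝ) → ℝ} (h : Matches d Λ c Φ) (hΦ : Integrable Φ (dm d))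
    (q : (Fin d → ℤ) → ℂ) : pair d Λ c q = ∫ θ, eval d Λ q θ * Φ θ ∂(dm d) := by
  have hint : ∀ k : Fin d → ℤ, Integrable (fun θ : Fin d → ℝ =>
      Complex.exp ((dotP d k θ : ℂ) * Complex.I) * (Φ θ : ℂ)) (dm d) := fun k => by
    refine hΦ.ofReal.bdd_mul (c := 1) (Continuous.aestronglyMeasurable ?_)
      (Filter.Eventually.of_forall fun θ => (Complex.norm_exp_ofReal_mul_I _).le)
    unfold dotP
    fun_prop
  have hsum : ∑ k ∈ Λ, c k * starRingEnd ℂ (q k) =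
      ∫ θ, starRingEnd ℂ (trigSum Λ q θ) * (Φ θ : ℂ) ∂(dm d) := by
    rw [Finset.sum_congr rfl fun k hk => by rw [h k hk, ← integral_mul_const],
      ← integral_finsetSum _ fun k _ => (hint k).mul_const _]
    refine integral_congr_ae (Filter.Eventually.of_forall fun θ => ?_)
    simp only [trigSum, map_sum, Finset.sum_mul]
    refine Finset.sum_congr rfl fun k _ => ?_
    rw [map_mul, ← Complex.exp_conj]
    simp
    ring
  have hint' : Integrable (fun θ => starRingEnd ℂ (trigSum Λ q θ) * (Φ θ : ℂ)) (dm d) :=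
    hΦ.ofReal.bdd_mul (continuous_conj.comp (continuous_trigSum Λ q)).aestronglyMeasurable
      (Filter.Eventually.of_forall fun θ => by
        simpa using norm_trigSum_le Λ q θ)
  rw [pair, hsum]
  refine (integral_re hint').symm.trans
    (integral_congr_ae (Filter.Eventually.of_forall fun θ => ?_))
  simp [eval, trigSum]

/-- The excess of the dual functional over its value at a moment-matching `Q`, as the integral of
a pointwise nonnegative function. -/
theorem J_sub_J_eq_integral {d : ℕ} {Λ : Finset (Fin d → ℤ)} (hΛ : ∀ k ∈ Λ, -k ∈ Λ)
    {c P Q R : (Fin d → ℤ) → ℂ} (hQ : Q ∈ Pbar d Λ \ {0}) (hR : R ∈ Pbar d Λ \ {0})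
    (hmatch : Matches d Λ c (fun θ => eval d Λ P θ / eval d Λ Q θ))
    (hΦ : Integrable (fun θ => eval d Λ P θ / eval d Λ Q θ) (dm d)) :
    Integrable (fun θ => eval d Λ P θ * (eval d Λ R θ / eval d Λ Q θ - 1 -
      Real.log (eval d Λ R θ / eval d Λ Q θ))) (dm d) ∧
    J d Λ c P R - J d Λ c P Q = ∫ θ, eval d Λ P θ * (eval d Λ R θ / eval d Λ Q θ - 1 -
      Real.log (eval d Λ R θ / eval d Λ Q θ)) ∂(dm d) := by
  have hlR := integrable_eval_mul (hR.1.1.integrable_log_eval hΛ hR.2) Λ P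
  have hlQ := integrable_eval_mul (hQ.1.1.integrable_log_eval hΛ hQ.2) Λ P
  have hR' := integrable_eval_mul hΦ Λ R
  have hQ' := integrable_eval_mul hΦ Λ Q
  have hae : (fun θ => (eval d Λ R θ * (eval d Λ P θ / eval d Λ Q θ) -
      eval d Λ P θ * Real.log (eval d Λ R θ)) - (eval d Λ Q θ * (eval d Λ P θ / eval d Λ Q θ) -
      eval d Λ P θ * Real.log (eval d Λ Q θ))) =ᵐ[dm d]
      fun θ => eval d Λ P θ * (eval d Λ R θ / eval d Λ Q θ - 1 -
        Real.log (eval d Λ R θ / eval d Λ Q θ)) := by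
    filter_upwards [hQ.1.1.ae_eval_ne_zero hΛ hQ.2, hR.1.1.ae_eval_ne_zero hΛ hR.2] with θ h1 h2
    rw [Real.log_div h2 h1]
    field_simp
    ring
  refine ⟨((hR'.sub hlR).sub (hQ'.sub hlQ)).congr hae, ?_⟩
  have hsub := integral_sub (hR'.sub hlR) (hQ'.sub hlQ)
  simp only [Pi.sub_apply] at hsub
  rw [← integral_congr_ae hae, hsub, integral_sub hR' hlR, integral_sub hQ' hlQ,
    ← hmatch.pair_eq_integral hΦ, ← hmatch.pair_eq_integral hΦ]
  rfl

theorem ae_eval_pos {d : ℕ} {Λ : Finset (Fin d → ℤ)} (hΛ : ∀ k ∈ Λ, -k ∈ Λ)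
    {p : (Fin d → ℤ) → ℂ} (hp : p ∈ Pbar d Λ \ {0}) : ∀ᵐ θ ∂(dm d), 0 < eval d Λ p θ := by
  filter_upwards [hp.1.1.ae_eval_ne_zero hΛ hp.2, ae_dm_of_ae_restrict
    (ae_restrict_mem (MeasurableSet.univ_pi fun _ => measurableSet_Ioc))] with θ h1 h2
  exact lt_of_le_of_ne (hp.1.2 θ h2) h1.symm

/-- if c ∈ ℭ₊ and dμ = (P/Q)dm with P, Q ∈ 𝔓̄₊ \ {0} satisfies the moment
conditions, then Q is the unique minimizer of the dual functional J_P over 𝔓̄₊ \ {0}. -/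
theorem statement1 (d : ℕ) (hd : 1 ≤ d) (Λ : Finset (Fin d → ℤ))
    (h0 : (0 : Fin d → ℤ) ∈ Λ) (hΛ : ∀ k ∈ Λ, -k ∈ Λ)
    (c P Q : (Fin d → ℤ) → ℂ) (hc : c ∈ Cplus d Λ)
    (hP : P ∈ Pbar d Λ \ {0}) (hQ : Q ∈ Pbar d Λ \ {0})
    (hmatch : Matches d Λ c (fun θ => eval d Λ P θ / eval d Λ Q θ)) :
    (∀ Q' ∈ Pbar d Λ \ {0}, J d Λ c P Q ≤ J d Λ c P Q') ∧
    ∀ Q' ∈ Pbar d Λ \ {0},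
      (∀ Q'' ∈ Pbar d Λ \ {0}, J d Λ c P Q' ≤ J d Λ c P Q'') → Q' = Q := by
  have hΦ := hmatch.integrable h0 hc
  have hnonneg : ∀ R ∈ Pbar d Λ \ {0}, 0 ≤ᵐ[dm d] fun θ => eval d Λ P θ *
      (eval d Λ R θ / eval d Λ Q θ - 1 - Real.log (eval d Λ R θ / eval d Λ Q θ)) := by
    intro R hR
    filter_upwards [ae_eval_pos hΛ hP, ae_eval_pos hΛ hQ, ae_eval_pos hΛ hR] with θ h1 h2 h3
    exact mul_nonneg h1.le (sub_nonneg.2 (Real.log_le_sub_one_of_pos (div_pos h3 h2)))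
  have hmin : ∀ R ∈ Pbar d Λ \ {0}, J d Λ c P Q ≤ J d Λ c P R := by
    intro R hR
    rw [← sub_nonneg, (J_sub_J_eq_integral hΛ hQ hR hmatch hΦ).2]
    exact integral_nonneg_of_ae (hnonneg R hR)
  refine ⟨hmin, fun R hR hRmin => ?_⟩
  obtain ⟨hint, heq⟩ := J_sub_J_eq_integral hΛ hQ hR hmatch hΦ
  rw [le_antisymm (hRmin Q hQ) (hmin R hR), sub_self] at heq
  have hzero := (integral_eq_zero_iff_of_nonneg_ae (hnonneg R hR) hint).1 heq.symm
  have hae : ∀ᵐ θ ∂(dm d), eval d Λ (R - Q) θ = 0 := by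
    filter_upwards [hzero, ae_eval_pos hΛ hP, ae_eval_pos hΛ hQ, ae_eval_pos hΛ hR]
      with θ h h1 h2 h3
    rw [eval_sub, sub_eq_zero, ← div_eq_one_iff_eq h2.ne']
    by_contra hne
    exact (mul_pos h1 (sub_pos.2 (Real.log_lt_sub_one_of_pos (div_pos h3 h2) hne))).ne' h
  by_contra hne
  have : NeZero (dm d) := ⟨dm_ne_zero d⟩
  obtain ⟨θ, h1, h2⟩ := (hae.and
    ((hR.1.1.sub hQ.1.1).ae_eval_ne_zero hΛ (sub_ne_zero.2 hne))).exists
  exact h2 h1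

end RCE
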